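/- arXiv:0706.3229 — 2 statements merged into one kernel-verified Lean document; each statement's English description precedes it below -/
import Mathlib

section
/- Let α = x₁²x₂x₃ + x₁x₂²x₃ + x₁x₂x₃² ∈ F₂[x₁,x₂,x₃] and let Sq¹ be the F₂-linear derivation on F₂[x₁,x₂,x₃] determined by Sq¹(xᵢ) = xᵢ². Then: (i) α = Sq¹(x₁x₂x₃); (ii) Sq¹(α) = 0; and (iii) τ_g(α) ≠ 0 for every g ≠ 0 in G = (ℤ/2)³. -/
open MvPolynomial

/-- The inverse transgression map with `F₂`-coefficients for `G = (ℤ/2)³`: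
`τ_g = a₁·∂/∂x₁ + a₂·∂/∂x₂ + a₃·∂/∂x₃` on `F₂[x₁,x₂,x₃]`. -/
noncomputable def tau (g : Fin 3 → ZMod 2) (P : MvPolynomial (Fin 3) (ZMod 2)) :
    MvPolynomial (Fin 3) (ZMod 2) :=
  ∑ i : Fin 3, C (g i) * pderiv i P

/-- `α = x₁²x₂x₃ + x₁x₂²x₃ + x₁x₂x₃² ∈ F₂[x₁,x₂,x₃]`. -/
noncomputable def alpha : MvPolynomial (Fin 3) (ZMod 2) :=
  X 0 ^ 2 * X 1 * X 2 + X 0 * X 1 ^ 2 * X 2 + X 0 * X 1 * X 2 ^ 2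

/-- The Steenrod square `Sq¹`: the `F₂`-linear derivation on `F₂[x₁,x₂,x₃]`
determined by `Sq¹(xᵢ) = xᵢ²`. -/
noncomputable def Sq1 :
    Derivation (ZMod 2) (MvPolynomial (Fin 3) (ZMod 2)) (MvPolynomial (Fin 3) (ZMod 2)) :=
  mkDerivation (ZMod 2) fun i : Fin 3 => X i ^ 2

theorem tau_alpha (g : Fin 3 → ZMod 2) :
    tau g alpha =
      C (g 0) * (X 1 ^ 2 * X 2 + X 1 * X 2 ^ 2) + C (g 1) * (X 0 ^ 2 * X 2 + X 0 * X 2 ^ 2) +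
        C (g 2) * (X 0 ^ 2 * X 1 + X 0 * X 1 ^ 2) := by
  have h2 : (2 : MvPolynomial (Fin 3) (ZMod 2)) = 0 := CharTwo.two_eq_zero
  simp only [tau, alpha, Fin.sum_univ_three, map_add, Derivation.leibniz, Derivation.leibniz_pow,
    pderiv_X, Pi.single_apply, smul_eq_mul, nsmul_eq_mul]
  simp
  linear_combination (C (g 0) + C (g 1) + C (g 2)) * X 0 * X 1 * X 2 * h2

theorem alpha_eq_Sq1 : alpha = Sq1 (X 0 * X 1 * X 2) := by
  simp only [alpha, Sq1, Derivation.leibniz, mkDerivation_X, smul_eq_mul]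
  ring

theorem Sq1_alpha : Sq1 alpha = 0 := by
  have h2 : (2 : MvPolynomial (Fin 3) (ZMod 2)) = 0 := CharTwo.two_eq_zero
  simp only [alpha, Sq1, map_add, Derivation.leibniz, Derivation.leibniz_pow, mkDerivation_X,
    smul_eq_mul, nsmul_eq_mul]
  push_cast
  linear_combination (X 0 * X 1 * X 2 * (X 0 ^ 2 + X 1 ^ 2 + X 2 ^ 2 + X 0 * X 1 + X 0 * X 2 +
    X 1 * X 2)) * h2

theorem eq_zero_of_tau_alpha_eq_zero {g : Fin 3 → ZMod 2} (h : tau g alpha = 0) : g = 0 := by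
  rw [tau_alpha] at h
  have key (v : Fin 3 → Polynomial (ZMod 2)) :=
    congrArg (fun p => (aeval v p).coeff 1) h
  have h0 := key ![0, Polynomial.X, 1]
  have h1 := key ![Polynomial.X, 0, 1]
  have h2 := key ![Polynomial.X, 1, 0]
  simp [Polynomial.coeff_X_pow, Polynomial.algebraMap_eq] at h0 h1 h2
  ext i
  fin_cases i <;> simp [h0, h1, h2]

/-- (i) `α = Sq¹(x₁x₂x₃)`; (ii) `Sq¹(α) = 0`; (iii) `τ_g(α) ≠ 0` for
every `g ≠ 0` in `G = (ℤ/2)³`. -/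
theorem alpha_sq1_and_transgression :
    alpha = Sq1 (X 0 * X 1 * X 2) ∧
    Sq1 alpha = 0 ∧
    (∀ g : Fin 3 → ZMod 2, g ≠ 0 → tau g alpha ≠ 0) := by
  exact ⟨alpha_eq_Sq1, Sq1_alpha, fun _ hg h => hg (eq_zero_of_tau_alpha_eq_zero h)⟩
end

section
/- Let G = (ℤ/2)³ and α = x₁²x₂x₃ + x₁x₂²x₃ + x₁x₂x₃² ∈ F₂[x₁,x₂,x₃]. For g, h ∈ G, the double inverse transgression τ_h(τ_g(α)) is nonzero if and only if g ≠ h, g ≠ 0, and h ≠ 0. Equivalently, the cross product over F₂ of g = (a₁,a₂,a₃) and h = (b₁,b₂,b₃) is zero exactly when g = 0, h = 0, or g = h. -/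
open MvPolynomial

/-- The cross product over `F₂` of `(a₁,a₂,a₃)` and `(b₁,b₂,b₃)`. -/
def cross (g h : Fin 3 → ZMod 2) : Fin 3 → ZMod 2 :=
  ![g 1 * h 2 + g 2 * h 1, g 2 * h 0 + g 0 * h 2, g 0 * h 1 + g 1 * h 0]

/-- The double transgression of `alpha` is the diagonal quadratic form whose coefficients are the
entries of the cross product. -/
theorem tau_tau_alpha (g h : Fin 3 → ZMod 2) :
    tau h (tau g alpha) = ∑ i : Fin 3, C (cross g h i) * X i ^ 2 := by
  have two_eq_zero : (2 : MvPolynomial (Fin 3) (ZMod 2)) = 0 := CharTwo.two_eq_zero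
  simp [tau, alpha, cross, Fin.sum_univ_three, pderiv_X, Pi.single_apply, Derivation.leibniz,
    Derivation.leibniz_pow, two_eq_zero]
  ring_nf

/-- A diagonal quadratic form vanishes only if all its coefficients do. -/
theorem sum_C_mul_X_sq_eq_zero_iff {σ R : Type*} [Fintype σ] [CommSemiring R] (c : σ → R) :
    (∑ i, C (c i) * X i ^ 2 : MvPolynomial σ R) = 0 ↔ c = 0 := by
  classical
  refine ⟨fun hc => funext fun j => ?_, fun hc => by simp [hc]⟩
  simpa [coeff_sum, coeff_C_mul, coeff_X_pow, Finsupp.single_left_inj] using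
    congrArg (coeff (Finsupp.single j 2)) hc

theorem cross_eq_zero_iff (g h : Fin 3 → ZMod 2) :
    cross g h = 0 ↔ g = 0 ∨ h = 0 ∨ g = h := by
  revert g h
  decide

/-- For `g, h ∈ (ℤ/2)³`, the double inverse transgression
`τ_h(τ_g(α))` is nonzero iff `g ≠ h`, `g ≠ 0` and `h ≠ 0`; equivalently, the cross
product of `g` and `h` over `F₂` vanishes exactly when `g = 0`, `h = 0` or `g = h`. -/
theorem double_transgression_nonzero_iff (g h : Fin 3 → ZMod 2) :
    (tau h (tau g alpha) ≠ 0 ↔ g ≠ h ∧ g ≠ 0 ∧ h ≠ 0) ∧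
    (cross g h = 0 ↔ g = 0 ∨ h = 0 ∨ g = h) := by
  refine ⟨?_, cross_eq_zero_iff g h⟩
  rw [Ne, tau_tau_alpha, sum_C_mul_X_sq_eq_zero_iff, cross_eq_zero_iff]
  tauto
end
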